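/- Let μ be a measure as in the context with μ(ℝ∖{0}) > 0, let c ∈ ℝ, and let f ∈ C¹(ℝ) be such that there exists δ₀ > 0 with f'(s) ≤ 0 for every s ≤ δ₀. Let u, v : ℝ → [0,1] be bounded functions of class C¹ such that for every x ∈ ℝ the principal values D_μ u(x) and D_μ v(x) exist, D_μ u(x) + c u'(x) + f(u(x)) ≤ 0 and D_μ v(x) + c v'(x) + f(v(x)) ≥ 0 for all x ∈ ℝ, the limits of u and v at ±∞ exist, lim_{x→+∞} u(x) ≥ 0, lim_{x→+∞} v(x) ≤ 0, lim_{x→−∞} u(x) ≥ 1, and lim_{x→−∞} v(x) < 1. Then u(x + τ) > v(x) for every τ ∈ ℝ and every x ∈ ℝ. -/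

import Mathlib

open MeasureTheory Filter Topology Set

/-- Truncated nonlocal operator `D_{μ,δ} u (x) = ∫_{|z| ≥ δ} (u(x+z) − u(x)) dμ(z)`. -/
noncomputable def Dtrunc (μ : Measure ℝ) (u : ℝ → ℝ) (δ : ℝ) (x : ℝ) : ℝ :=
  ∫ z in {z : ℝ | δ ≤ |z|}, (u (x + z) - u x) ∂μ

/-- The principal value `D_μ u (x)` exists and equals `L`. -/
def HasPV (μ : Measure ℝ) (u : ℝ → ℝ) (x : ℝ) (L : ℝ) : Prop :=
  Tendsto (fun δ => Dtrunc μ u δ x) (𝓝[>] (0 : ℝ)) (𝓝 L)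

/-- A symmetric diffuse Lévy measure as in the paper. -/
structure LevyMeasure (μ : Measure ℝ) : Prop where
  symm : Measure.map (fun z : ℝ => -z) μ = μ
  moment : ∫⁻ z, ENNReal.ofReal (min 1 (z ^ 2)) ∂μ < ⊤
  diffuse : ∀ x : ℝ, x ≠ 0 → μ {x} = 0

/-- A bistable nonlinearity with threshold `θ`. -/
structure Bistable (f : ℝ → ℝ) (θ : ℝ) : Prop where
  smooth : ContDiff ℝ 1 f
  f0 : f 0 = 0
  f1 : f 1 = 0
  df1 : deriv f 1 < 0
  θ_mem : θ ∈ Set.Ioo (0 : ℝ) 1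
  df0 : deriv f 0 < 0
  neg : ∀ s ∈ Set.Ioo (0 : ℝ) θ, f s < 0
  fθ : f θ = 0
  pos : ∀ s ∈ Set.Ioo θ (1 : ℝ), 0 < f s
  dfθ : 0 < deriv f θ

/-- An ignition nonlinearity with threshold `θ`. -/
structure Ignition (f : ℝ → ℝ) (θ : ℝ) : Prop where
  smooth : ContDiff ℝ 1 f
  f1 : f 1 = 0
  df1 : deriv f 1 < 0
  θ_mem : θ ∈ Set.Ioo (0 : ℝ) 1
  zero : ∀ s ∈ Set.Icc (0 : ℝ) θ, f s = 0
  pos : ∀ s ∈ Set.Ioo θ (1 : ℝ), 0 < f s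

/-- A monostable nonlinearity. -/
structure Monostable (f : ℝ → ℝ) : Prop where
  smooth : ContDiff ℝ 1 f
  f0 : f 0 = 0
  f1 : f 1 = 0
  df1 : deriv f 1 < 0
  pos : ∀ s ∈ Set.Ioo (0 : ℝ) 1, 0 < f s



lemma levy_pos_dir (μ : Measure ℝ) (hμ : LevyMeasure μ) (hμ0 : 0 < μ ({(0 : ℝ)}ᶜ)) :
    ∃ z : ℝ, 0 < z ∧ (∀ t ∈ 𝓝 z, 0 < μ t) ∧ (∀ t ∈ 𝓝 (-z), 0 < μ t) := by
  have key : ∀ z : ℝ, (∀ t ∈ 𝓝 z, 0 < μ t) → (∀ t ∈ 𝓝 (-z), 0 < μ t) := by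
    intro z hz t ht
    obtain ⟨s, hst, hso, hzs⟩ := mem_nhds_iff.1 ht
    have h1 : μ s = μ ((fun z : ℝ => -z) ⁻¹' s) := by
      conv_lhs => rw [← hμ.symm]
      rw [Measure.map_apply measurable_neg hso.measurableSet]
    refine lt_of_lt_of_le ?_ (measure_mono hst)
    rw [h1]
    exact hz _ ((hso.preimage continuous_neg).mem_nhds hzs)
  obtain ⟨z, hz, h⟩ := exists_mem_forall_mem_nhdsWithin_pos_measure hμ0.ne'
  have hz0 : z ≠ 0 := hz
  have h' : ∀ t ∈ 𝓝 z, 0 < μ t := fun t ht => h t (mem_nhdsWithin_of_mem_nhds ht)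
  rcases lt_or_gt_of_ne hz0 with hlt | hgt
  · exact ⟨-z, by linarith, key z h', by simpa using h'⟩
  · exact ⟨z, hgt, h', key z h'⟩

lemma measSet_trunc (δ : ℝ) : MeasurableSet {z : ℝ | δ ≤ |z|} :=
  (isClosed_le continuous_const continuous_abs).measurableSet

lemma levy_finite (μ : Measure ℝ) (hμ : LevyMeasure μ) {δ : ℝ} (hδ : 0 < δ) :
    μ {z : ℝ | δ ≤ |z|} < ⊤ := by
  have hm : Measurable (fun z : ℝ => ENNReal.ofReal (min 1 (z ^ 2))) := by fun_prop
  have hpos : 0 < min 1 (δ ^ 2) := by positivity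
  have h := meas_ge_le_lintegral_div (μ := μ) hm.aemeasurable
    (ε := ENNReal.ofReal (min 1 (δ ^ 2))) (ENNReal.ofReal_pos.2 hpos).ne' ENNReal.ofReal_ne_top
  refine lt_of_le_of_lt (measure_mono ?_) (lt_of_le_of_lt h ?_)
  · intro z hz
    have hz' : δ ≤ |z| := hz
    apply ENNReal.ofReal_le_ofReal
    apply min_le_min le_rfl
    rw [← sq_abs z]
    gcongr
  · exact ENNReal.div_lt_top hμ.moment.ne (ENNReal.ofReal_pos.2 hpos).ne'

lemma integrable_trunc (μ : Measure ℝ) (hμ : LevyMeasure μ) {δ : ℝ} (hδ : 0 < δ)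
    (g : ℝ → ℝ) (hg : Continuous g) (C : ℝ) (hC : ∀ z, |g z| ≤ C) :
    IntegrableOn g {z : ℝ | δ ≤ |z|} μ :=
  Measure.integrableOn_of_bounded (M := C) (levy_finite μ hμ hδ).ne hg.aestronglyMeasurable
    (ae_of_all _ (by simpa using hC))

lemma int_diff (μ : Measure ℝ) (hμ : LevyMeasure μ) {δ : ℝ} (hδ : 0 < δ)
    (g : ℝ → ℝ) (hg : Continuous g) (C : ℝ) (hC : ∀ z, |g z| ≤ C) (x : ℝ) :
    IntegrableOn (fun z => g (x + z) - g x) {z : ℝ | δ ≤ |z|} μ := by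
  refine integrable_trunc μ hμ hδ _ (by fun_prop) (C + C) (fun z => ?_)
  exact (abs_sub _ _).trans (add_le_add (hC _) (hC _))

/-- Strong maximum principle at a global maximum. -/
lemma strong_max (μ : Measure ℝ) (hμ : LevyMeasure μ) (w : ℝ → ℝ) (hw : Continuous w)
    (C : ℝ) (hC : ∀ z, |w z| ≤ C) (x : ℝ) (hx : ∀ y, w y ≤ w x) (L : ℝ)
    (hL : HasPV μ w x L) (hL0 : 0 ≤ L) (z : ℝ) (hz : z ≠ 0) (hzs : ∀ t ∈ 𝓝 z, 0 < μ t) :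
    w (x + z) = w x := by
  have hmono : ∀ δ : ℝ, 0 < δ → 0 ≤ Dtrunc μ w δ x := by
    intro δ hδ
    refine hL0.trans ?_
    refine le_of_tendsto hL ?_
    filter_upwards [Ioo_mem_nhdsGT hδ] with δ' hδ'
    have h := setIntegral_mono_set (μ := μ) (f := fun z => -(w (x + z) - w x))
      (s := {z : ℝ | δ ≤ |z|}) (t := {z : ℝ | δ' ≤ |z|})
      (int_diff μ hμ hδ'.1 w hw C hC x).neg
      (ae_of_all _ (fun y => by have := hx (x + y); simp; linarith))
      (HasSubset.Subset.eventuallyLE (fun y hy => le_trans hδ'.2.le hy))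
    rw [integral_neg, integral_neg] at h
    unfold Dtrunc
    linarith
  by_contra hne
  have hlt : w (x + z) < w x := lt_of_le_of_ne (hx _) hne
  have hδ : 0 < |z| / 2 := by positivity
  set δ := |z| / 2
  have h0 := hmono δ hδ
  have hint := int_diff μ hμ hδ w hw C hC x
  have hz1 : ∫ z in {z : ℝ | δ ≤ |z|}, -(w (x + z) - w x) ∂μ = 0 := by
    apply le_antisymm
    · rw [integral_neg]; unfold Dtrunc at h0; linarith
    · exact integral_nonneg (fun y => by have := hx (x + y); simp; linarith)
  have hae := (integral_eq_zero_iff_of_nonneg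
    (fun y => by have := hx (x + y); simp; linarith) hint.neg).1 hz1
  have hae2 : ∀ᵐ y ∂μ, δ ≤ |y| → -(w (x + y) - w x) = 0 :=
    (ae_restrict_iff' (measSet_trunc δ)).1 hae
  have hn : {y : ℝ | δ < |y| ∧ w (x + y) < w x} ∈ 𝓝 z := by
    apply IsOpen.mem_nhds
    · exact (isOpen_lt continuous_const continuous_abs).inter
        (isOpen_lt (show Continuous (fun y => w (x + y)) by fun_prop) continuous_const)
    · refine ⟨?_, hlt⟩
      have : 0 < |z| := by positivity
      change |z| / 2 < |z|
      linarith
  have hp := hzs _ hn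
  have : μ {y : ℝ | δ < |y| ∧ w (x + y) < w x} = 0 := by
    refine measure_mono_null ?_ hae2
    intro y hy hcon
    have := hcon hy.1.le
    have := hy.2
    linarith
  exact hp.ne' this

lemma pv_shift (μ : Measure ℝ) (u : ℝ → ℝ) (τ x L : ℝ) (h : HasPV μ u (x + τ) L) :
    HasPV μ (fun y => u (y + τ)) x L := by
  have : (fun δ => Dtrunc μ (fun y => u (y + τ)) δ x) = fun δ => Dtrunc μ u δ (x + τ) := by
    funext δ
    unfold Dtrunc
    simp only [add_right_comm]
  unfold HasPV
  rw [this]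
  exact h

lemma pv_sub (μ : Measure ℝ) (hμ : LevyMeasure μ) (u v : ℝ → ℝ) (hu : Continuous u)
    (hv : Continuous v) (hub : ∀ z, |u z| ≤ 1) (hvb : ∀ z, |v z| ≤ 1) (x L M : ℝ)
    (h : HasPV μ u x L) (h' : HasPV μ v x M) :
    HasPV μ (fun y => v y - u y) x (M - L) := by
  refine (h'.sub h).congr' ?_
  filter_upwards [self_mem_nhdsWithin] with δ hδ
  unfold Dtrunc
  rw [← integral_sub (int_diff μ hμ hδ v hv 1 hvb x) (int_diff μ hμ hδ u hu 1 hub x)]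
  congr 1
  funext z
  ring

lemma quad_bound (p q : ℝ) :
    -2 * min 1 (q ^ 2) ≤ 1 / (1 + (p + q) ^ 2) + 1 / (1 + (p - q) ^ 2) - 2 / (1 + p ^ 2) := by
  have hA : 0 < 1 + (p + q) ^ 2 := by positivity
  have hB : 0 < 1 + (p - q) ^ 2 := by positivity
  have hP : 0 < 1 + p ^ 2 := by positivity
  have hQ : 0 < 1 + p ^ 2 + q ^ 2 := by positivity
  have h1 : 2 / (1 + p ^ 2 + q ^ 2) ≤ 1 / (1 + (p + q) ^ 2) + 1 / (1 + (p - q) ^ 2) := by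
    rw [div_add_div _ _ hA.ne' hB.ne', div_le_div_iff₀ hQ (by positivity)]
    nlinarith [sq_nonneg (p * q)]
  have h2 : 2 / (1 + p ^ 2) ≤ 2 := by
    rw [div_le_iff₀ hP]; nlinarith [sq_nonneg p]
  have h3 : 0 < 2 / (1 + p ^ 2 + q ^ 2) := by positivity
  have h4 : -2 * q ^ 2 ≤ 2 / (1 + p ^ 2 + q ^ 2) - 2 / (1 + p ^ 2) := by
    rw [div_sub_div _ _ hQ.ne' hP.ne', le_div_iff₀ (by positivity)]
    have : 1 ≤ (1 + p ^ 2 + q ^ 2) * (1 + p ^ 2) := by nlinarith [sq_nonneg p, sq_nonneg q, mul_nonneg (sq_nonneg p) (sq_nonneg q), mul_nonneg (sq_nonneg p) (sq_nonneg p)]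
    nlinarith [sq_nonneg q, mul_le_mul_of_nonneg_left this (sq_nonneg q)]
  rcases le_total 1 (q ^ 2) with h | h
  · rw [min_eq_left h]; linarith
  · rw [min_eq_right h]; linarith

lemma levy_integrable (μ : Measure ℝ) (hμ : LevyMeasure μ) :
    Integrable (fun z : ℝ => min 1 (z ^ 2)) μ := by
  refine ⟨by fun_prop, ?_⟩
  rw [hasFiniteIntegral_iff_ofReal (ae_of_all _ (fun z => by positivity))]
  exact hμ.moment

lemma small_scale (μ : Measure ℝ) (hμ : LevyMeasure μ) :
    Tendsto (fun ε : ℝ => ∫ z, min 1 ((ε * z) ^ 2) ∂μ) (𝓝[>] 0) (𝓝 0) := by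
  have h : Tendsto (fun ε : ℝ => ∫ z, min 1 ((ε * z) ^ 2) ∂μ) (𝓝[>] 0)
      (𝓝 (∫ z : ℝ, (0 : ℝ) ∂μ)) := by
    refine tendsto_integral_filter_of_dominated_convergence (fun z => min 1 (z ^ 2))
      (Eventually.of_forall (fun ε => by fun_prop)) ?_ (levy_integrable μ hμ) ?_
    · filter_upwards [Ioo_mem_nhdsGT (zero_lt_one' ℝ)] with ε hε
      refine ae_of_all _ (fun z => ?_)
      rw [Real.norm_of_nonneg (by positivity)]
      apply min_le_min le_rfl
      have : ε ^ 2 ≤ 1 := by nlinarith [hε.1, hε.2]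
      rw [mul_pow]
      nlinarith [sq_nonneg z]
    · refine ae_of_all _ (fun z => ?_)
      have hc : Continuous (fun ε : ℝ => min 1 ((ε * z) ^ 2)) := by fun_prop
      have := (hc.tendsto 0).mono_left (nhdsWithin_le_nhds (s := Ioi 0))
      simpa using this
  simpa using h

/-- The rational bump. -/
noncomputable def bumpφ (ε y₀ x : ℝ) : ℝ := 2 * (1 / (1 + (ε * (x - y₀)) ^ 2))

lemma bump_cont (ε y₀ : ℝ) : Continuous (bumpφ ε y₀) := by
  unfold bumpφ
  refine continuous_const.mul (continuous_const.div (by fun_prop) (fun x => by positivity))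

lemma bump_abs (ε y₀ x : ℝ) : |bumpφ ε y₀ x| ≤ 2 := by
  unfold bumpφ
  rw [abs_of_nonneg (by positivity)]
  have : 1 / (1 + (ε * (x - y₀)) ^ 2) ≤ 1 := by
    rw [div_le_iff₀ (by positivity)]; nlinarith [sq_nonneg (ε * (x - y₀))]
  linarith

lemma bump_D (μ : Measure ℝ) (hμ : LevyMeasure μ) (ε y₀ x δ : ℝ) (hε1 : ε ^ 2 ≤ 1) (hδ : 0 < δ) :
    -2 * ∫ z, min 1 ((ε * z) ^ 2) ∂μ ≤ Dtrunc μ (bumpφ ε y₀) δ x := by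
  set φ := bumpφ ε y₀
  have hsym : Dtrunc μ φ δ x = ∫ z in {z : ℝ | δ ≤ |z|}, (φ (x + -z) - φ x) ∂μ := by
    unfold Dtrunc
    conv_lhs => rw [← hμ.symm]
    rw [setIntegral_map (measSet_trunc δ)
      (by have := bump_cont ε y₀; exact Continuous.aestronglyMeasurable (by fun_prop))
      measurable_neg.aemeasurable]
    simp
  have hi1 := int_diff μ hμ hδ φ (bump_cont ε y₀) 2 (bump_abs ε y₀) x
  have hi2 : IntegrableOn (fun z => φ (x + -z) - φ x) {z : ℝ | δ ≤ |z|} μ := by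
    have := bump_cont ε y₀
    refine integrable_trunc μ hμ hδ _ (by fun_prop) (2 + 2) (fun z => ?_)
    exact (abs_sub _ _).trans (add_le_add (bump_abs ε y₀ _) (bump_abs ε y₀ _))
  have hsum : 2 * Dtrunc μ φ δ x =
      ∫ z in {z : ℝ | δ ≤ |z|}, ((φ (x + z) - φ x) + (φ (x + -z) - φ x)) ∂μ := by
    rw [integral_add hi1 hi2, ← hsym]
    unfold Dtrunc
    ring
  have hI : Integrable (fun z : ℝ => min 1 ((ε * z) ^ 2)) μ := by
    refine (levy_integrable μ hμ).mono' (by fun_prop) (ae_of_all _ (fun z => ?_))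
    rw [Real.norm_of_nonneg (by positivity)]
    apply min_le_min le_rfl
    rw [mul_pow]
    nlinarith [sq_nonneg z]
  have h1 : ∫ z in {z : ℝ | δ ≤ |z|}, (-4 * min 1 ((ε * z) ^ 2)) ∂μ ≤ 2 * Dtrunc μ φ δ x := by
    rw [hsum]
    refine integral_mono (hI.integrableOn.const_mul _) (hi1.add hi2) (fun z => ?_)
    have := quad_bound (ε * (x - y₀)) (ε * z)
    simp only [φ, bumpφ]
    rw [show ε * (x + z - y₀) = ε * (x - y₀) + ε * z by ring,
      show ε * (x + -z - y₀) = ε * (x - y₀) - ε * z by ring]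
    have e : 2 / (1 + (ε * (x - y₀)) ^ 2) = 2 * (1 / (1 + (ε * (x - y₀)) ^ 2)) := by ring
    rw [e] at this
    linarith
  rw [integral_const_mul] at h1
  have h2 : ∫ z in {z : ℝ | δ ≤ |z|}, min 1 ((ε * z) ^ 2) ∂μ ≤ ∫ z, min 1 ((ε * z) ^ 2) ∂μ :=
    setIntegral_le_integral hI (ae_of_all _ (fun z => by positivity))
  linarith

lemma bump_deriv (ε y₀ x : ℝ) : ∃ d, HasDerivAt (bumpφ ε y₀) d x ∧ |d| ≤ 4 * |ε| := by
  have h0 : HasDerivAt (fun x => 1 + (ε * (x - y₀)) ^ 2) (2 * (ε * (x - y₀)) * ε) x := by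
    have := (((((hasDerivAt_id x).sub_const y₀).const_mul ε).pow 2).const_add 1)
    have e : (2 * (ε * (x - y₀)) * ε) = (((2 : ℕ) : ℝ) * (ε * (id x - y₀)) ^ (2 - 1) * (ε * 1)) := by
      simp
    rw [e]
    exact this
  have hP : 0 < 1 + (ε * (x - y₀)) ^ 2 := by positivity
  have h1 := ((h0.fun_inv hP.ne').const_mul 2)
  have e : bumpφ ε y₀ = fun x => 2 * (1 + (ε * (x - y₀)) ^ 2)⁻¹ := by
    funext x; simp [bumpφ]
  rw [e]
  refine ⟨_, h1, ?_⟩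
  set q := ε * (x - y₀)
  rw [abs_mul, abs_div, abs_neg, abs_mul, abs_mul, abs_of_pos (show (0:ℝ) < 2 by norm_num),
    abs_of_pos (by positivity : 0 < (1 + q ^ 2) ^ 2)]
  rw [← mul_div_assoc, div_le_iff₀ (by positivity)]
  have : |q| ≤ (1 + q ^ 2) ^ 2 := by
    rw [← sq_abs q]; nlinarith [sq_nonneg (|q| - 1), sq_nonneg (|q|), sq_nonneg (|q| ^ 2)]
  nlinarith [abs_nonneg ε]

lemma f_one_nonpos (μ : Measure ℝ) (hμ : LevyMeasure μ)
    (c : ℝ) (f : ℝ → ℝ) (hf : Continuous f) (u : ℝ → ℝ)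
    (hur : ∀ x, u x ∈ Set.Icc (0 : ℝ) 1) (hu1 : ContDiff ℝ 1 u)
    (hu : ∀ x, ∃ L : ℝ, HasPV μ u x L ∧ L + c * deriv u x + f (u x) ≤ 0)
    (hub : Tendsto u atBot (𝓝 1)) : f 1 ≤ 0 := by
  by_contra! hpos
  have hcu := hu1.continuous
  have hfu : Tendsto (fun x => f (u x)) atBot (𝓝 (f 1)) := (hf.tendsto 1).comp hub
  obtain ⟨R, hR⟩ := eventually_atBot.1 (hfu.eventually_const_lt (show f 1 / 2 < f 1 by linarith))
  have hc1 : Tendsto (fun ε : ℝ => 2 * (∫ z, min 1 ((ε * z) ^ 2) ∂μ) + |c| * (4 * |ε|))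
      (𝓝[>] 0) (𝓝 (2 * 0 + |c| * (4 * |0|))) := by
    refine ((small_scale μ hμ).const_mul 2).add ?_
    have : Continuous (fun ε : ℝ => |c| * (4 * |ε|)) := by fun_prop
    exact (this.tendsto 0).mono_left nhdsWithin_le_nhds
  obtain ⟨ε, ⟨hε0, hε1⟩, hε⟩ := ((show ∀ᶠ ε in 𝓝[>] (0:ℝ), ε ∈ Ioo 0 1 from Ioo_mem_nhdsGT (zero_lt_one' ℝ)).and
    (hc1.eventually_lt_const (show 2 * 0 + |c| * (4 * |0|) < f 1 / 2 by simp; linarith))).exists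
  set y₀ := R - 1 / ε
  have hφc := bump_cont ε y₀
  set φ := bumpφ ε y₀ with hφ
  have hφ0 : φ y₀ = 2 := by simp [hφ, bumpφ]
  have hfar : ∀ x, 1 / ε ≤ |x - y₀| → φ x ≤ 1 := by
    intro x hx
    have h1 : 1 ≤ (ε * (x - y₀)) ^ 2 := by
      rw [← sq_abs, abs_mul, abs_of_pos hε0]
      have : 1 ≤ ε * |x - y₀| := by
        rw [div_le_iff₀ hε0] at hx; linarith
      nlinarith
    simp only [hφ, bumpφ]
    rw [mul_one_div, div_le_one (by positivity)]
    linarith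
  have hε' : 0 < 1 / ε := by positivity
  obtain ⟨x₁, hx₁⟩ := (hcu.sub hφc).exists_forall_le' y₀ (by
    rw [cocompact_eq_atBot_atTop, eventually_sup]
    have h0 := (hur y₀).2
    constructor
    · filter_upwards [eventually_le_atBot (y₀ - 1 / ε)] with x hx
      have h1 := hfar x (by rw [abs_of_nonpos (by linarith)]; linarith)
      have := (hur x).1
      simp only [Pi.sub_apply]; linarith
    · filter_upwards [eventually_ge_atTop (y₀ + 1 / ε)] with x hx
      have h1 := hfar x (by rw [abs_of_nonneg (by linarith)]; linarith)
      have := (hur x).1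
      simp only [Pi.sub_apply]; linarith)
  obtain ⟨x₀, hx₀, hx₀R⟩ : ∃ x₀, (∀ y, u x₀ - φ x₀ ≤ u y - φ y) ∧ x₀ ≤ R := by
    by_cases h : x₁ ≤ R
    · exact ⟨x₁, hx₁, h⟩
    · push Not at h
      refine ⟨y₀, fun y => le_trans ?_ (hx₁ y), by simp only [y₀]; linarith⟩
      have h1 := hfar x₁ (by rw [abs_of_nonneg (by simp only [y₀]; linarith)]; simp only [y₀]; linarith)
      have := (hur x₁).1
      have h0 := (hur y₀).2
      simp only [Pi.sub_apply]; linarith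
  obtain ⟨L, hL, hLe⟩ := hu x₀
  obtain ⟨d, hd, hdb⟩ := bump_deriv ε y₀ x₀
  have hdu : deriv u x₀ = d := by
    have hdu := (hu1.differentiable one_ne_zero x₀).hasDerivAt.sub hd
    have hm : IsLocalMin (u - φ) x₀ := Eventually.of_forall hx₀
    have := hm.hasDerivAt_eq_zero hdu
    linarith
  have hLge : -2 * ∫ z, min 1 ((ε * z) ^ 2) ∂μ ≤ L := by
    refine ge_of_tendsto hL ?_
    filter_upwards [self_mem_nhdsWithin] with δ hδ
    refine (bump_D μ hμ ε y₀ x₀ δ (by nlinarith) hδ).trans ?_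
    refine integral_mono (int_diff μ hμ hδ φ hφc 2 (bump_abs ε y₀) x₀)
      (int_diff μ hμ hδ u hcu 1 (fun z => abs_le.2 ⟨by linarith [(hur z).1], (hur z).2⟩) x₀)
      (fun z => ?_)
    have := hx₀ (x₀ + z)
    simp only [φ] at this ⊢
    linarith
  have h1 := hR x₀ hx₀R
  have h2 : -(|c| * (4 * |ε|)) ≤ c * d := by
    have : |c * d| ≤ |c| * (4 * |ε|) := by rw [abs_mul]; gcongr
    linarith [neg_abs_le (c * d)]
  rw [hdu] at hLe
  linarith

/-- nonlinear comparison principle via sliding (Theorem A.4). -/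
theorem nonlinear_comparison_principle
    (μ : Measure ℝ) (hμ : LevyMeasure μ) (hμ0 : 0 < μ ({(0 : ℝ)}ᶜ))
    (c : ℝ) (f : ℝ → ℝ) (hf : ContDiff ℝ 1 f)
    (δ₀ : ℝ) (hδ₀ : 0 < δ₀) (hf' : ∀ s : ℝ, s ≤ δ₀ → deriv f s ≤ 0)
    (u v : ℝ → ℝ)
    (hur : ∀ x, u x ∈ Set.Icc (0 : ℝ) 1) (hvr : ∀ x, v x ∈ Set.Icc (0 : ℝ) 1)
    (hu1 : ContDiff ℝ 1 u) (hv1 : ContDiff ℝ 1 v)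
    (hu : ∀ x, ∃ L : ℝ, HasPV μ u x L ∧ L + c * deriv u x + f (u x) ≤ 0)
    (hv : ∀ x, ∃ L : ℝ, HasPV μ v x L ∧ 0 ≤ L + c * deriv v x + f (v x))
    (hut : ∃ l : ℝ, Tendsto u atTop (𝓝 l) ∧ 0 ≤ l)
    (hvt : ∃ l : ℝ, Tendsto v atTop (𝓝 l) ∧ l ≤ 0)
    (hub : ∃ l : ℝ, Tendsto u atBot (𝓝 l) ∧ 1 ≤ l)
    (hvb : ∃ l : ℝ, Tendsto v atBot (𝓝 l) ∧ l < 1) :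
    ∀ τ x : ℝ, v x < u (x + τ) := by
  obtain ⟨z, hz, hzp, hzn⟩ := levy_pos_dir μ hμ hμ0
  obtain ⟨lut, hut, hlut⟩ := hut
  obtain ⟨lvt, hvt, hlvt⟩ := hvt
  obtain ⟨lub, hub, hlub⟩ := hub
  obtain ⟨lvb, hvb, hlvb⟩ := hvb
  have hlub1 : lub = 1 := le_antisymm (le_of_tendsto' hub (fun x => (hur x).2)) hlub
  subst hlub1
  have hcu := hu1.continuous
  have hcv := hv1.continuous
  have hua : ∀ x, |u x| ≤ 1 := fun x => abs_le.2 ⟨by linarith [(hur x).1], (hur x).2⟩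
  have hva : ∀ x, |v x| ≤ 1 := fun x => abs_le.2 ⟨by linarith [(hvr x).1], (hvr x).2⟩
  have hf1 := f_one_nonpos μ hμ c f hf.continuous u hur hu1 hu hub
  have hseqT : ∀ x : ℝ, Tendsto (fun n : ℕ => x + n * z) atTop atTop := fun x =>
    tendsto_atTop_add_const_left _ _ (tendsto_natCast_atTop_atTop.atTop_mul_const hz)
  have hseqB : ∀ x : ℝ, Tendsto (fun n : ℕ => x + n * (-z)) atTop atBot := fun x =>
    tendsto_atBot_add_const_left _ _ (tendsto_natCast_atTop_atTop.atTop_mul_const_of_neg (by linarith))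
  have hanti : AntitoneOn f (Iic δ₀) := by
    refine antitoneOn_of_deriv_nonpos (convex_Iic _) hf.continuous.continuousOn
      (hf.differentiable one_ne_zero).differentiableOn ?_
    intro x hx
    have hxm : x ∈ Iic δ₀ := interior_subset hx
    exact hf' x hxm
  have hv_lt : ∀ x, v x < 1 := by
    intro x
    by_contra! hx
    have hx1 : v x = 1 := le_antisymm (hvr x).2 hx
    have step : ∀ y, v y = 1 → v (y + z) = 1 := by
      intro y hy
      obtain ⟨L, hL, hLe⟩ := hv y
      have hmax : ∀ t, v t ≤ v y := fun t => by rw [hy]; exact (hvr t).2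
      have hd : deriv v y = 0 := IsLocalMax.deriv_eq_zero (Eventually.of_forall hmax)
      rw [hd, hy] at hLe
      rw [strong_max μ hμ v hcv 1 hva y hmax L hL (by linarith) z hz.ne' hzp, hy]
    have hall : ∀ n : ℕ, v (x + n * z) = 1 := by
      intro n
      induction n with
      | zero => simpa using hx1
      | succ n ih =>
        have := step _ ih
        rw [← this]; congr 1; push_cast; ring
    have := tendsto_nhds_unique ((hvt.comp (hseqT x)).congr hall) tendsto_const_nhds
    linarith
  have prop : ∀ τ x, (∀ y, v y - u (y + τ) ≤ v x - u (x + τ)) → f (v x) ≤ f (u (x + τ)) →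
      ∀ s, s ≠ 0 → (∀ t ∈ 𝓝 s, 0 < μ t) →
      v (x + s) - u (x + s + τ) = v x - u (x + τ) := by
    intro τ x hmax hfx s hs hsp
    obtain ⟨M, hM, hMe⟩ := hv x
    obtain ⟨L, hL, hLe⟩ := hu (x + τ)
    have hpv := pv_sub μ hμ (fun y => u (y + τ)) v (by fun_prop) hcv (fun y => hua _) hva x L M
      (pv_shift μ u τ x L hL) hM
    have hd : deriv v x - deriv u (x + τ) = 0 := by
      have h1 := ((hu1.differentiable one_ne_zero (x + τ)).hasDerivAt).comp_add_const x τ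
      have h2 := ((hv1.differentiable one_ne_zero x).hasDerivAt).fun_sub h1
      have hm : IsLocalMax (fun y => v y - u (y + τ)) x := Eventually.of_forall hmax
      exact hm.hasDerivAt_eq_zero h2
    have hc : c * deriv v x = c * deriv u (x + τ) := by rw [sub_eq_zero.1 hd]
    exact strong_max μ hμ (fun y => v y - u (y + τ)) (by fun_prop) (1 + 1)
      (fun y => (abs_sub _ _).trans (add_le_add (hva _) (hua _))) x hmax (M - L) hpv
      (by linarith) s hs hsp
  obtain ⟨R, hR⟩ := eventually_atTop.1
    (hvt.eventually_lt_const (show lvt < δ₀ by linarith))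
  have wT : ∀ τ, Tendsto (fun x => v x - u (x + τ)) atTop (𝓝 (lvt - lut)) := fun τ =>
    hvt.sub (hut.comp (tendsto_atTop_add_const_right _ τ tendsto_id))
  have wB : ∀ τ, Tendsto (fun x => v x - u (x + τ)) atBot (𝓝 (lvb - 1)) := fun τ =>
    hvb.sub (hub.comp (tendsto_atBot_add_const_right _ τ tendsto_id))
  have lemA : ∀ τ, (∀ x ≤ R, v x ≤ u (x + τ)) → ∀ x, v x ≤ u (x + τ) := by
    intro τ hτ x
    by_contra! hx
    obtain ⟨x₀, hx₀⟩ := (show Continuous (fun x => v x - u (x + τ)) by fun_prop).exists_forall_ge' x (by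
      rw [cocompact_eq_atBot_atTop, eventually_sup]
      constructor
      · filter_upwards [(wB τ).eventually_lt_const
          (show lvb - 1 < v x - u (x + τ) by linarith)] with y hy using hy.le
      · filter_upwards [(wT τ).eventually_lt_const
          (show lvt - lut < v x - u (x + τ) by linarith)] with y hy using hy.le)
    have hpos : 0 < v x₀ - u (x₀ + τ) := by linarith [hx₀ x]
    have hall : ∀ n : ℕ, v (x₀ + n * z) - u (x₀ + n * z + τ) = v x₀ - u (x₀ + τ) := by
      intro n
      induction n with
      | zero => simp
      | succ n ih =>
        set y := x₀ + n * z with hy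
        have hyR : R ≤ y := by
          by_contra! h
          linarith [hτ y h.le]
        have hvy := (hR y hyR).le
        have hlt : u (y + τ) ≤ v y := by linarith
        have := prop τ y (fun t => by rw [ih]; exact hx₀ t)
          (hanti (show u (y + τ) ≤ δ₀ by linarith) hvy hlt) z hz.ne' hzp
        rw [show x₀ + ((n + 1 : ℕ) : ℝ) * z = y + z by rw [hy]; push_cast; ring, this, ih]
    have := tendsto_nhds_unique (((wT τ).comp (hseqT x₀)).congr hall) tendsto_const_nhds
    linarith
  have lemB : ∀ τ, (∀ x, v x ≤ u (x + τ)) → ∀ x, v x < u (x + τ) := by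
    intro τ hτ x
    by_contra! hx
    have hall : ∀ n : ℕ, v (x + n * (-z)) - u (x + n * (-z) + τ) = 0 := by
      intro n
      induction n with
      | zero => have := hτ x; simp; linarith
      | succ n ih =>
        set y := x + n * (-z) with hy
        have := prop τ y (fun t => by rw [ih]; linarith [hτ t])
          (by rw [sub_eq_zero.1 ih]) (-z) (by simpa using hz.ne') hzn
        rw [show x + ((n + 1 : ℕ) : ℝ) * (-z) = y + -z by rw [hy]; push_cast; ring, this, ih]
    have := tendsto_nhds_unique (((wB τ).comp (hseqB x)).congr hall) tendsto_const_nhds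
    linarith
  obtain ⟨κ, hκ1, hκ2⟩ := exists_between hlvb
  obtain ⟨N, hN⟩ := eventually_atBot.1 (hvb.eventually_lt_const hκ1)
  obtain ⟨K, hK⟩ := eventually_atBot.1 (hub.eventually_const_lt hκ2)
  have hne : ∃ τ, ∀ x, v x ≤ u (x + τ) := by
    obtain ⟨κ', hκ', hvκ⟩ : ∃ κ' < 1, ∀ x ∈ Icc N R, v x ≤ κ' := by
      rcases (Icc N R).eq_empty_or_nonempty with h | h
      · exact ⟨0, one_pos.trans_le' le_rfl, by simp [h]⟩
      · obtain ⟨m, hm, hmm⟩ := isCompact_Icc.exists_isMaxOn h hcv.continuousOn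
        exact ⟨v m, hv_lt m, fun x hx => hmm hx⟩
    obtain ⟨K', hK'⟩ := eventually_atBot.1 (hub.eventually_const_lt (max_lt hκ2 hκ'))
    refine ⟨K' - R, lemA _ (fun x hx => ?_)⟩
    have h1 := hK' (x + (K' - R)) (by linarith)
    rcases le_total x N with h | h
    · exact ((hN x h).trans ((le_max_left _ _).trans_lt h1)).le
    · exact (hvκ x ⟨h, hx⟩).trans ((le_max_right _ _).trans h1.le)
  have hclopen : IsClopen {τ : ℝ | ∀ x, v x ≤ u (x + τ)} := by
    constructor
    · rw [setOf_forall]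
      exact isClosed_iInter (fun x => isClosed_le continuous_const (by fun_prop))
    · rw [isOpen_iff_mem_nhds]
      intro τ hτ
      have hs := lemB τ hτ
      set A := min N (K - (τ + 1)) with hA
      have h2 : ∀ᶠ τ' in 𝓝 τ, ∀ x ∈ Icc A R, v x < u (x + τ') := by
        refine isCompact_Icc.eventually_forall_of_forall_eventually (fun x _ => ?_)
        have ho : IsOpen {p : ℝ × ℝ | v p.2 < u (p.2 + p.1)} :=
          isOpen_lt (by fun_prop) (by fun_prop)
        exact ho.mem_nhds (hs x)
      filter_upwards [h2, eventually_le_nhds (show τ < τ + 1 by linarith)] with τ' h2 h3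
      refine lemA τ' (fun x hx => ?_)
      rcases le_total x A with h | h
      · have a1 : x ≤ N := h.trans (min_le_left _ _)
        have a2 : x ≤ K - (τ + 1) := h.trans (min_le_right _ _)
        exact ((hN x a1).trans (hK (x + τ') (by linarith))).le
      · exact (h2 x ⟨h, hx⟩).le
  have huniv := hclopen.eq_univ hne
  intro τ
  exact lemB τ (by have : τ ∈ {τ : ℝ | ∀ x, v x ≤ u (x + τ)} := by rw [huniv]; trivial
                   exact this)
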